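/- Suppose the feasible set of the K-base-station spectrum allocation problem is nonempty. Then the objective f attains its minimum over the feasible set: there exists a feasible allocation x* with f(x*) ≤ f(x) for every feasible allocation x. -/

import Mathlib

open Finset

noncomputable section

/-- Service rate of base station `i` induced by spectrum allocation `x`,
    where `s i B` is the spectral efficiency of station `i` on spectrum shared by `B`. -/
def rate {K : ℕ} (s : Fin K → Finset (Fin K) → ℝ) (x : Finset (Fin K) → ℝ) (i : Fin K) : ℝ :=
  ∑ B : Finset (Fin K), s i B * x B

/-- A feasible spectrum allocation: nonnegative, sums to one, and every queue is stable. -/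
def Feasible {K : ℕ} (s : Fin K → Finset (Fin K) → ℝ) (lam : Fin K → ℝ)
    (x : Finset (Fin K) → ℝ) : Prop :=
  (∀ B, 0 ≤ x B) ∧ (∑ B : Finset (Fin K), x B = 1) ∧ (∀ i, lam i < rate s x i)

/-- Conservative weighted mean packet sojourn time. -/
def obj {K : ℕ} (s : Fin K → Finset (Fin K) → ℝ) (lam : Fin K → ℝ)
    (x : Finset (Fin K) → ℝ) : ℝ :=
  ∑ i : Fin K, (lam i / ∑ j : Fin K, lam j) / (rate s x i - lam i)

theorem continuous_rate {K : ℕ} (s : Fin K → Finset (Fin K) → ℝ) (i : Fin K) :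
    Continuous fun x => rate s x i := by
  unfold rate
  fun_prop

theorem weight_pos {K : ℕ} {lam : Fin K → ℝ} (hlam : ∀ i, 0 < lam i) (i : Fin K) :
    0 < lam i / ∑ j : Fin K, lam j :=
  div_pos (hlam i) (Finset.sum_pos (fun j _ => hlam j) ⟨i, Finset.mem_univ i⟩)

/-- A bound on the objective bounds the slack of every station away from zero. -/
theorem Feasible.weight_le_mul_slack {K : ℕ} {s : Fin K → Finset (Fin K) → ℝ}
    {lam : Fin K → ℝ} (hlam : ∀ i, 0 < lam i) {x : Finset (Fin K) → ℝ}
    (hx : Feasible s lam x) {M : ℝ} (hM : obj s lam x ≤ M) (i : Fin K) :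
    lam i / ∑ j : Fin K, lam j ≤ M * (rate s x i - lam i) := by
  have hpos : ∀ j, 0 < rate s x j - lam j := fun j => sub_pos.2 (hx.2.2 j)
  rw [← div_le_iff₀ (hpos i)]
  refine le_trans ?_ hM
  exact Finset.single_le_sum
    (f := fun j => (lam j / ∑ k : Fin K, lam k) / (rate s x j - lam j))
    (fun j _ => (div_pos (weight_pos hlam j) (hpos j)).le) (Finset.mem_univ i)

/-- The simplex points with nonnegative slack that satisfy the sublevel bound at `M`. -/
def slackSet {K : ℕ} (s : Fin K → Finset (Fin K) → ℝ) (lam : Fin K → ℝ) (M : ℝ) :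
    Set (Finset (Fin K) → ℝ) :=
  stdSimplex ℝ (Finset (Fin K)) ∩ {x | ∀ i, lam i ≤ rate s x i ∧
    lam i / ∑ j : Fin K, lam j ≤ M * (rate s x i - lam i)}

theorem isCompact_slackSet {K : ℕ} (s : Fin K → Finset (Fin K) → ℝ) (lam : Fin K → ℝ)
    (M : ℝ) : IsCompact (slackSet s lam M) := by
  refine (isCompact_stdSimplex ℝ _).inter_right ?_
  simp only [Set.ofPred_forall]
  refine isClosed_iInter fun i => ?_
  have hr := continuous_rate s i
  exact (isClosed_le continuous_const hr).inter
    (isClosed_le continuous_const (continuous_const.mul (hr.sub continuous_const)))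

theorem feasible_of_mem_slackSet {K : ℕ} {s : Fin K → Finset (Fin K) → ℝ}
    {lam : Fin K → ℝ} (hlam : ∀ i, 0 < lam i) {M : ℝ} {x : Finset (Fin K) → ℝ}
    (hx : x ∈ slackSet s lam M) : Feasible s lam x := by
  refine ⟨hx.1.1, hx.1.2, fun i => (hx.2 i).1.lt_of_ne fun h => ?_⟩
  have hle := (hx.2 i).2
  rw [← h, sub_self, mul_zero] at hle
  exact (weight_pos hlam i).not_ge hle

theorem Feasible.mem_slackSet {K : ℕ} {s : Fin K → Finset (Fin K) → ℝ}
    {lam : Fin K → ℝ} (hlam : ∀ i, 0 < lam i) {x : Finset (Fin K) → ℝ}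
    (hx : Feasible s lam x) {M : ℝ} (hM : obj s lam x ≤ M) : x ∈ slackSet s lam M :=
  ⟨⟨hx.1, hx.2.1⟩, fun i => ⟨(hx.2.2 i).le, hx.weight_le_mul_slack hlam hM i⟩⟩

theorem continuousOn_obj {K : ℕ} (s : Fin K → Finset (Fin K) → ℝ) (lam : Fin K → ℝ) :
    ContinuousOn (obj s lam) {x | Feasible s lam x} := by
  refine continuousOn_finsetSum _ fun i _ => ?_
  exact continuousOn_const.div ((continuous_rate s i).sub continuous_const).continuousOn
    fun x hx => (sub_pos.2 (hx.2.2 i)).ne'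

/-- If the feasible set is nonempty, the objective attains its minimum. -/
theorem obj_attains_min {K : ℕ} (hK : 1 ≤ K)
    (s : Fin K → Finset (Fin K) → ℝ)
    (hs : ∀ i B, 0 ≤ s i B)
    (hs0 : ∀ i B, i ∉ B → s i B = 0)
    (lam : Fin K → ℝ) (hlam : ∀ i, 0 < lam i)
    (hne : ∃ x, Feasible s lam x) :
    ∃ xstar, Feasible s lam xstar ∧
      ∀ x, Feasible s lam x → obj s lam xstar ≤ obj s lam x := by
  obtain ⟨x₀, hx₀⟩ := hne
  obtain ⟨y, hy, hmin⟩ := (isCompact_slackSet s lam (obj s lam x₀)).exists_isMinOn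
    ⟨x₀, hx₀.mem_slackSet hlam le_rfl⟩
    ((continuousOn_obj s lam).mono fun x hx => feasible_of_mem_slackSet hlam hx)
  refine ⟨y, feasible_of_mem_slackSet hlam hy, fun x hx => ?_⟩
  rcases le_total (obj s lam x) (obj s lam x₀) with h | h
  · exact hmin (hx.mem_slackSet hlam h)
  · exact le_trans (hmin (hx₀.mem_slackSet hlam le_rfl)) h
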